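/- Positivity of the linearized operator on the comparison function (Lemma 2.15). Fix n ≥ 2, constants C_E ≥ 1 and C_S > 0, positive numbers r₀, r₁ with r₁ ≤ r₀ and 3r₀ ≤ 1, a point x₁ ∈ ℝⁿ with ‖x₁‖ = 2r₀, and set C_H := 2( C_E²((n−1)(C_S + 1) + 2) + 1 ) and α := −2 + C_E(1 + nC_E + n³C_E(C_H+1)). Let δ > 0 satisfy δ ≤ r₀^{α+2}/α and set w(x) := ‖x‖^{−α}. Let U ⊆ ℝⁿ×ℝ×ℝⁿ be open with every fiber U_x convex and let M (given by a^{ij}, b) be uniformly elliptic on U with constant C_E. Let x_* ∈ B(x₁,r₁) and let φ₀, φ₁ be U-admissible C² functions on a neighborhood of x_* such that: (a) f := (φ₁ − φ₀) + δw has a local maximum at x_*; (b) D²φ₁(x_*) ≥ −C_S·I; (c) M[φ₀](x_*) ≤ C_E. Define the linear operator L_{φ₀,φ₁} := Σ_{i,j} A^{ij}[φ₀,φ₁] D_{ij} + Σ_i B^i[φ₀,φ₁] D_i, where A^{ij}[φ₀,φ₁](x) := ∫₀¹ a^{ij}(x,φ_t(x),Dφ_t(x)) dt and B^i[φ₀,φ₁](x)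 := ∫₀¹ ( Σ_{j,k} (∂a^{jk}/∂p^i)(x,φ_t,Dφ_t) D_{jk}φ_t + (∂b/∂p^i)(x,φ_t,Dφ_t) ) dt with φ_t := (1−t)φ₀ + tφ₁. Then L_{φ₀,φ₁}w(x_*) ≥ 1. -/

import Mathlib

open scoped BigOperators

noncomputable section

abbrev Euc (n : ℕ) := EuclideanSpace ℝ (Fin n)

def pd (n : ℕ) (i : Fin n) (u : Euc n → ℝ) (x : Euc n) : ℝ :=
  fderiv ℝ u x (EuclideanSpace.single i 1)

def pd2 (n : ℕ) (i j : Fin n) (u : Euc n → ℝ) (x : Euc n) : ℝ :=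
  fderiv ℝ (fun y => fderiv ℝ u y (EuclideanSpace.single j 1)) x (EuclideanSpace.single i 1)

def hessM (n : ℕ) (u : Euc n → ℝ) (x : Euc n) : Matrix (Fin n) (Fin n) ℝ :=
  Matrix.of fun i j => pd2 n i j u x

def hessMax (n : ℕ) (u : Euc n → ℝ) (x : Euc n) : ℝ :=
  ⨆ i : Fin n, ⨆ j : Fin n, |pd2 n i j u x|

def MEval (n : ℕ) (a : Euc n × ℝ × Euc n → Fin n → Fin n → ℝ)
    (b : Euc n × ℝ × Euc n → ℝ) (u : Euc n → ℝ) (x : Euc n) : ℝ :=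
  (∑ i, ∑ j, a (x, u x, gradient u x) i j * pd2 n i j u x) + b (x, u x, gradient u x)

def da_r (n : ℕ) (a : Euc n × ℝ × Euc n → Fin n → Fin n → ℝ)
    (z : Euc n × ℝ × Euc n) (i j : Fin n) : ℝ :=
  fderiv ℝ (fun rp : ℝ × Euc n => a (z.1, rp.1, rp.2) i j) z.2 (1, 0)

def da_p (n : ℕ) (a : Euc n × ℝ × Euc n → Fin n → Fin n → ℝ)
    (z : Euc n × ℝ × Euc n) (k i j : Fin n) : ℝ :=
  fderiv ℝ (fun rp : ℝ × Euc n => a (z.1, rp.1, rp.2) i j) z.2 (0, EuclideanSpace.single k 1)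

def db_r (n : ℕ) (b : Euc n × ℝ × Euc n → ℝ) (z : Euc n × ℝ × Euc n) : ℝ :=
  fderiv ℝ (fun rp : ℝ × Euc n => b (z.1, rp.1, rp.2)) z.2 (1, 0)

def db_p (n : ℕ) (b : Euc n × ℝ × Euc n → ℝ) (z : Euc n × ℝ × Euc n) (k : Fin n) : ℝ :=
  fderiv ℝ (fun rp : ℝ × Euc n => b (z.1, rp.1, rp.2)) z.2 (0, EuclideanSpace.single k 1)

def UniformlyElliptic (n : ℕ) (U : Set (Euc n × ℝ × Euc n))
    (a : Euc n × ℝ × Euc n → Fin n → Fin n → ℝ) (b : Euc n × ℝ × Euc n → ℝ)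
    (CE : ℝ) : Prop :=
  (∀ z ∈ U, ∀ i j, a z i j = a z j i) ∧
  (∀ i j, ContinuousOn (fun z => a z i j) U) ∧
  ContinuousOn b U ∧
  (∀ x : Euc n, ∀ i j, ContDiffOn ℝ 1 (fun rp : ℝ × Euc n => a (x, rp.1, rp.2) i j)
      {rp : ℝ × Euc n | (x, rp.1, rp.2) ∈ U}) ∧
  (∀ x : Euc n, ContDiffOn ℝ 1 (fun rp : ℝ × Euc n => b (x, rp.1, rp.2))
      {rp : ℝ × Euc n | (x, rp.1, rp.2) ∈ U}) ∧
  (∀ z ∈ U, ∀ ξ : Fin n → ℝ,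
      (1 / CE) * (∑ i, ξ i ^ 2) ≤ ∑ i, ∑ j, a z i j * ξ i * ξ j ∧
      (∑ i, ∑ j, a z i j * ξ i * ξ j) ≤ CE * (∑ i, ξ i ^ 2)) ∧
  (∀ z ∈ U, ∀ i j k,
      |da_p n a z k i j| ≤ CE ∧ |da_r n a z i j| ≤ CE ∧
      |db_p n b z k| ≤ CE ∧ |db_r n b z| ≤ CE ∧ |b z| ≤ CE)

def UAdmissibleOn (n : ℕ) (U : Set (Euc n × ℝ × Euc n)) (s : Set (Euc n))
    (u : Euc n → ℝ) : Prop :=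
  ∀ x ∈ s, (x, u x, gradient u x) ∈ U

def MLeSupport (n : ℕ) (U : Set (Euc n × ℝ × Euc n))
    (a : Euc n × ℝ × Euc n → Fin n → Fin n → ℝ) (b : Euc n × ℝ × Euc n → ℝ)
    (Ω : Set (Euc n)) (u : Euc n → ℝ) (H₀ : ℝ) : Prop :=
  ∀ ε > (0 : ℝ), ∀ x ∈ Ω, ∃ (φ : Euc n → ℝ) (N : Set (Euc n)),
    IsOpen N ∧ x ∈ N ∧ ContDiffOn ℝ 2 φ N ∧ UAdmissibleOn n U N φ ∧
    φ x = u x ∧ (∀ y ∈ N ∩ Ω, u y ≤ φ y) ∧ MEval n a b φ x ≤ H₀ + ε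

def MGeSupportHess (n : ℕ) (U : Set (Euc n × ℝ × Euc n))
    (a : Euc n × ℝ × Euc n → Fin n → Fin n → ℝ) (b : Euc n × ℝ × Euc n → ℝ)
    (Ω : Set (Euc n)) (v : Euc n → ℝ) (H₀ : ℝ) : Prop :=
  ∃ CS > (0 : ℝ), ∀ ε > (0 : ℝ), ∀ x ∈ Ω, ∃ (ψ : Euc n → ℝ) (N : Set (Euc n)),
    IsOpen N ∧ x ∈ N ∧ ContDiffOn ℝ 2 ψ N ∧ UAdmissibleOn n U N ψ ∧
    ψ x = v x ∧ (∀ y ∈ N ∩ Ω, ψ y ≤ v y) ∧ H₀ - ε ≤ MEval n a b ψ x ∧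
    (hessM n ψ x + CS • (1 : Matrix (Fin n) (Fin n) ℝ)).PosSemidef


/-- The interpolation `φ_t = (1-t)φ₀ + tφ₁`. -/
def phit (n : ℕ) (φ₀ φ₁ : Euc n → ℝ) (t : ℝ) : Euc n → ℝ :=
  fun x => (1 - t) * φ₀ x + t * φ₁ x

/-- Linearization coefficient `A^{ij}[φ₀,φ₁]`. -/
def Acoef (n : ℕ) (a : Euc n × ℝ × Euc n → Fin n → Fin n → ℝ)
    (φ₀ φ₁ : Euc n → ℝ) (i j : Fin n) (x : Euc n) : ℝ :=
  ∫ t in (0:ℝ)..1,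
    a (x, phit n φ₀ φ₁ t x, gradient (phit n φ₀ φ₁ t) x) i j

/-- Linearization coefficient `B^i[φ₀,φ₁]`. -/
def Bcoef (n : ℕ) (a : Euc n × ℝ × Euc n → Fin n → Fin n → ℝ)
    (b : Euc n × ℝ × Euc n → ℝ) (φ₀ φ₁ : Euc n → ℝ) (i : Fin n) (x : Euc n) : ℝ :=
  ∫ t in (0:ℝ)..1,
    ((∑ j, ∑ k, da_p n a (x, phit n φ₀ φ₁ t x, gradient (phit n φ₀ φ₁ t) x) i j k *
        pd2 n j k (phit n φ₀ φ₁ t) x) +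
      db_p n b (x, phit n φ₀ φ₁ t x, gradient (phit n φ₀ φ₁ t) x) i)

/-- Linearization coefficient `C[φ₀,φ₁]`. -/
def Ccoef (n : ℕ) (a : Euc n × ℝ × Euc n → Fin n → Fin n → ℝ)
    (b : Euc n × ℝ × Euc n → ℝ) (φ₀ φ₁ : Euc n → ℝ) (x : Euc n) : ℝ :=
  ∫ t in (0:ℝ)..1,
    ((∑ i, ∑ j, da_r n a (x, phit n φ₀ φ₁ t x, gradient (phit n φ₀ φ₁ t) x) i j *
        pd2 n i j (phit n φ₀ φ₁ t) x) +
      db_r n b (x, phit n φ₀ φ₁ t x, gradient (phit n φ₀ φ₁ t) x))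

section SecondOrder

variable {n : ℕ}

lemma pd2_eq_fderiv_fderiv {u : Euc n → ℝ} {x : Euc n} (hu : ContDiffAt ℝ 2 u x) (i j : Fin n) :
    pd2 n i j u x = fderiv ℝ (fderiv ℝ u) x (EuclideanSpace.single i 1)
      (EuclideanSpace.single j 1) := by
  have h : DifferentiableAt ℝ (fderiv ℝ u) x :=
    (hu.fderiv_right (m := 1) (by norm_num)).differentiableAt (by norm_num)
  simp [pd2, fderiv_clm_apply h (differentiableAt_const _)]

lemma pd2_symm {u : Euc n → ℝ} {x : Euc n} (hu : ContDiffAt ℝ 2 u x) (i j : Fin n) :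
    pd2 n i j u x = pd2 n j i u x := by
  rw [pd2_eq_fderiv_fderiv hu, pd2_eq_fderiv_fderiv hu]
  exact hu.isSymmSndFDerivAt (by simp) _ _

lemma sum_pd2_mul_mul {u : Euc n → ℝ} {x : Euc n} (hu : ContDiffAt ℝ 2 u x) (v : Fin n → ℝ) :
    ∑ i, ∑ j, pd2 n i j u x * v i * v j =
      fderiv ℝ (fderiv ℝ u) x (WithLp.toLp 2 v) (WithLp.toLp 2 v) := by
  have hv : (WithLp.toLp 2 v : Euc n) = ∑ i, v i • EuclideanSpace.single i (1 : ℝ) := by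
    ext k
    simp [Finset.sum_apply, Pi.single_apply]
  simp only [pd2_eq_fderiv_fderiv hu, hv, map_sum, map_smul, _root_.sum_apply,
    _root_.smul_apply, smul_eq_mul, Finset.mul_sum]
  rw [Finset.sum_comm]
  refine Finset.sum_congr rfl fun i _ => Finset.sum_congr rfl fun j _ => by ring

lemma pd2_const_mul_add_const_mul {u v : Euc n → ℝ} {x : Euc n} (hu : ContDiffAt ℝ 2 u x)
    (hv : ContDiffAt ℝ 2 v x) (c d : ℝ) (i j : Fin n) :
    pd2 n i j (fun y => c * u y + d * v y) x = c * pd2 n i j u x + d * pd2 n i j v x := by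
  have diff : ∀ {f : Euc n → ℝ}, ContDiffAt ℝ 2 f x → DifferentiableAt ℝ (fderiv ℝ f) x :=
    fun hf => (hf.fderiv_right (m := 1) (by norm_num)).differentiableAt (by norm_num)
  have ev : ∀ {f : Euc n → ℝ}, ContDiffAt ℝ 2 f x → ∀ᶠ y in nhds x, DifferentiableAt ℝ f y :=
    fun hf => (hf.eventually (by simp)).mono fun y hy => hy.differentiableAt (by norm_num)
  have key : fderiv ℝ (fun y => c * u y + d * v y) =ᶠ[nhds x]
      fun y => c • fderiv ℝ u y + d • fderiv ℝ v y := by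
    filter_upwards [ev hu, ev hv] with y h1 h2
    rw [fderiv_fun_add (h1.const_mul c) (h2.const_mul d), fderiv_const_mul h1,
      fderiv_const_mul h2]
  rw [pd2_eq_fderiv_fderiv (by fun_prop), key.fderiv_eq,
    fderiv_fun_add ((diff hu).fun_const_smul c) ((diff hv).fun_const_smul d),
    fderiv_fun_const_smul (diff hu), fderiv_fun_const_smul (diff hv),
    pd2_eq_fderiv_fderiv hu, pd2_eq_fderiv_fderiv hv]
  simp

/-- Second-order necessary condition at a local maximum, on the real line. -/
lemma deriv_deriv_nonpos_of_isLocalMax {g : ℝ → ℝ} {t : ℝ} (hg : ContinuousAt g t)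
    (h : IsLocalMax g t) : deriv (deriv g) t ≤ 0 := by
  by_contra! hpos
  have hmin := isLocalMin_of_deriv_deriv_pos hpos h.deriv_eq_zero hg
  have hconst : g =ᶠ[nhds t] fun _ => g t := by
    filter_upwards [h, hmin] with s h1 h2 using le_antisymm h1 h2
  have : deriv (deriv g) t = 0 := by
    rw [hconst.deriv.deriv_eq]
    simp
  exact hpos.ne' this

lemma fderiv_fderiv_nonpos_of_isLocalMax {E : Type*} [NormedAddCommGroup E] [NormedSpace ℝ E]
    {f : E → ℝ} {x : E} (hf : ContDiffAt ℝ 2 f x) (h : IsLocalMax f x) (v : E) :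
    fderiv ℝ (fderiv ℝ f) x v v ≤ 0 := by
  have hline : ∀ t : ℝ, HasDerivAt (fun t : ℝ => x + t • v) v t := fun t => by
    simpa using ((hasDerivAt_id t).smul_const v).const_add x
  have hl0 : x + (0 : ℝ) • v = x := by simp
  have htend : Filter.Tendsto (fun t : ℝ => x + t • v) (nhds 0) (nhds x) := by
    simpa using (hline 0).continuousAt.tendsto
  have hd : ∀ᶠ y in nhds x, DifferentiableAt ℝ f y :=
    (hf.eventually (by simp)).mono fun y hy => hy.differentiableAt (by norm_num)
  have hderiv : deriv (fun t : ℝ => f (x + t • v)) =ᶠ[nhds 0]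
      fun t => fderiv ℝ f (x + t • v) v := by
    filter_upwards [htend.eventually hd] with t ht
    exact (ht.hasFDerivAt.comp_hasDerivAt t (hline t)).deriv
  have hdd : DifferentiableAt ℝ (fderiv ℝ f) x :=
    (hf.fderiv_right (m := 1) (by norm_num)).differentiableAt (by norm_num)
  have h2 : HasDerivAt (fun t : ℝ => fderiv ℝ f (x + t • v) v)
      (fderiv ℝ (fderiv ℝ f) x v v) 0 := by
    have h3 : HasFDerivAt (fderiv ℝ f) (fderiv ℝ (fderiv ℝ f) x) (x + (0 : ℝ) • v) := by
      rw [hl0]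
      exact hdd.hasFDerivAt
    exact (ContinuousLinearMap.apply ℝ ℝ v).hasFDerivAt.comp_hasDerivAt (0 : ℝ)
      (h3.comp_hasDerivAt (0 : ℝ) (hline 0))
  rw [← h2.deriv, ← hderiv.deriv_eq]
  refine deriv_deriv_nonpos_of_isLocalMax ?_ ?_
  · refine ContinuousAt.comp (g := f) ?_ (hline 0).continuousAt
    rw [hl0]
    exact hf.continuousAt
  · filter_upwards [htend.eventually h] with t ht
    simpa using ht

end SecondOrder

section QuadraticForms

variable {n : ℕ}

lemma posSemidef_hessM_add_smul_iff {u : Euc n → ℝ} {x : Euc n} (hu : ContDiffAt ℝ 2 u x)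
    (c : ℝ) :
    (hessM n u x + c • (1 : Matrix (Fin n) (Fin n) ℝ)).PosSemidef ↔
      ∀ v : Fin n → ℝ, -c * ∑ i, v i ^ 2 ≤ ∑ i, ∑ j, pd2 n i j u x * v i * v j := by
  have hsymm : (hessM n u x + c • (1 : Matrix (Fin n) (Fin n) ℝ)).IsHermitian := by
    ext i j
    simp [hessM, pd2_symm hu i j, Matrix.one_apply, eq_comm]
  rw [Matrix.posSemidef_iff_dotProduct_mulVec, and_iff_right hsymm]
  refine forall_congr' fun v => ?_
  have : star v ⬝ᵥ ((hessM n u x + c • (1 : Matrix (Fin n) (Fin n) ℝ)).mulVec v) =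
      (∑ i, ∑ j, pd2 n i j u x * v i * v j) + c * ∑ i, v i ^ 2 := by
    rw [Matrix.add_mulVec, Matrix.smul_mulVec, Matrix.one_mulVec, dotProduct_add,
      dotProduct_smul]
    simp only [dotProduct, Matrix.mulVec, hessM, Matrix.of_apply, Finset.mul_sum, smul_eq_mul,
      star_trivial]
    congr 1
    · exact Finset.sum_congr rfl fun i _ => Finset.sum_congr rfl fun j _ => by ring
    · exact Finset.sum_congr rfl fun i _ => by ring
  rw [this]
  constructor <;> intro h <;> linarith

lemma Matrix.PosSemidef.exists_sum_mul {H : Matrix (Fin n) (Fin n) ℝ} (hH : H.PosSemidef) :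
    ∃ B : Fin n → Fin n → ℝ, ∀ i j, H i j = ∑ k, B k i * B k j := by
  obtain ⟨B, rfl⟩ := by
    open scoped MatrixOrder in
    exact CStarAlgebra.nonneg_iff_eq_star_mul_self.mp hH.nonneg
  exact ⟨B, fun i j => by simp [Matrix.mul_apply, Matrix.star_apply]⟩

lemma Matrix.PosSemidef.quadratic_le_trace {H : Matrix (Fin n) (Fin n) ℝ} (hH : H.PosSemidef)
    (v : Fin n → ℝ) :
    ∑ i, ∑ j, H i j * v i * v j ≤ (∑ i, H i i) * ∑ i, v i ^ 2 := by
  obtain ⟨B, hB⟩ := hH.exists_sum_mul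
  have h1 : ∑ i, ∑ j, H i j * v i * v j = ∑ k, (∑ i, B k i * v i) ^ 2 := by
    simp only [hB, sq, Finset.sum_mul_sum]
    simp only [Finset.sum_mul]
    rw [Finset.sum_congr rfl fun i _ => Finset.sum_comm, Finset.sum_comm]
    exact Finset.sum_congr rfl fun k _ => Finset.sum_congr rfl fun i _ =>
      Finset.sum_congr rfl fun j _ => by ring
  have h2 : ∑ i, H i i = ∑ k, ∑ i, B k i ^ 2 := by
    simp only [hB]
    rw [Finset.sum_comm]
    simp only [sq]
  rw [h1, h2, Finset.sum_mul]
  exact Finset.sum_le_sum fun k _ => Finset.sum_mul_sq_le_sq_mul_sq _ _ _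

/-- Pairing a positive semidefinite matrix with an elliptic one controls its trace. -/
lemma Matrix.PosSemidef.mul_trace_le_sum {H : Matrix (Fin n) (Fin n) ℝ} (hH : H.PosSemidef)
    {A : Fin n → Fin n → ℝ} {c : ℝ}
    (hA : ∀ ξ : Fin n → ℝ, c * ∑ i, ξ i ^ 2 ≤ ∑ i, ∑ j, A i j * ξ i * ξ j) :
    c * ∑ i, H i i ≤ ∑ i, ∑ j, A i j * H i j := by
  obtain ⟨B, hB⟩ := hH.exists_sum_mul
  have h1 : ∑ i, ∑ j, A i j * H i j = ∑ k, ∑ i, ∑ j, A i j * B k i * B k j := by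
    simp only [hB, Finset.mul_sum]
    rw [Finset.sum_congr rfl fun i _ => Finset.sum_comm, Finset.sum_comm]
    exact Finset.sum_congr rfl fun k _ => Finset.sum_congr rfl fun i _ =>
      Finset.sum_congr rfl fun j _ => by ring
  have h2 : ∑ i, H i i = ∑ k, ∑ i, B k i ^ 2 := by
    simp only [hB]
    rw [Finset.sum_comm]
    simp only [sq]
  rw [h1, h2, Finset.mul_sum]
  exact Finset.sum_le_sum fun k _ => hA (B k)

/-- Evaluating a bilinear form on a sum of two coordinate vectors. -/
lemma sum_single_add_mul (D : Fin n → Fin n → ℝ) (i j : Fin n) (c : ℝ) :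
    ∑ k, ∑ l, D k l * (Pi.single i 1 + Pi.single j c : Fin n → ℝ) k *
        (Pi.single i 1 + Pi.single j c : Fin n → ℝ) l =
      D i i + c * (D i j + D j i) + c ^ 2 * D j j := by
  simp [Pi.single_apply, mul_add, add_mul, Finset.sum_add_distrib]
  ring

lemma abs_entry_le_of_quadratic_bounds {D : Fin n → Fin n → ℝ} (hD : ∀ i j, D i j = D j i)
    {c C : ℝ} (hcC : c ≤ C) (hlow : ∀ v : Fin n → ℝ,
      -c * ∑ i, v i ^ 2 ≤ ∑ i, ∑ j, D i j * v i * v j)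
    (hupp : ∀ v : Fin n → ℝ, ∑ i, ∑ j, D i j * v i * v j ≤ C * ∑ i, v i ^ 2) (i j : Fin n) :
    |D i j| ≤ C := by
  have hsq : ∀ s : ℝ, ∑ k, (Pi.single i 1 + Pi.single j s : Fin n → ℝ) k ^ 2 =
      1 + 2 * s * (if i = j then 1 else 0) + s ^ 2 := fun s => by
    by_cases hij : i = j
    · simp [sq, Pi.single_apply, mul_add, add_mul, Finset.sum_add_distrib, hij]
      ring
    · simp [sq, Pi.single_apply, mul_add, add_mul, Finset.sum_add_distrib, hij, Ne.symm hij]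
  have hl := fun s => hlow (Pi.single i 1 + Pi.single j s)
  have hu := fun s => hupp (Pi.single i 1 + Pi.single j s)
  simp only [hsq, sum_single_add_mul] at hl hu
  have l1 := hl 1
  have l2 := hl (-1)
  have u1 := hu 1
  have u2 := hu (-1)
  have := hD i j
  rw [abs_le]
  by_cases hij : i = j
  · simp only [hij, if_true] at *
    constructor <;> linarith
  · simp only [hij, if_false] at *
    constructor <;> linarith

end QuadraticForms

section PowerOfNorm

lemma contDiffAt_norm_rpow {E : Type*} [NormedAddCommGroup E] [InnerProductSpace ℝ E]
    {m : WithTop ℕ∞} (p : ℝ) {x : E} (hx : x ≠ 0) :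
    ContDiffAt ℝ m (fun y : E => ‖y‖ ^ p) x :=
  (contDiffAt_norm ℝ hx).rpow_const_of_ne (norm_ne_zero_iff.mpr hx)

lemma hasFDerivAt_norm_rpow_of_ne_zero {E : Type*} [NormedAddCommGroup E]
    [InnerProductSpace ℝ E] (p : ℝ) {x : E} (hx : x ≠ 0) :
    HasFDerivAt (fun y : E => ‖y‖ ^ p) ((p * ‖x‖ ^ (p - 2)) • innerSL ℝ x) x := by
  have hx0 : 0 < ‖x‖ := norm_pos_iff.mpr hx
  have hpow : ∀ (y : E) (q : ℝ), (‖y‖ ^ 2) ^ (q / 2) = ‖y‖ ^ q := fun y q => by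
    rw [← Real.rpow_natCast, ← Real.rpow_mul (norm_nonneg y)]
    congr 1
    push_cast
    ring
  have h := (hasStrictFDerivAt_norm_sq x).hasFDerivAt.rpow_const (p := p / 2)
    (Or.inl (by positivity))
  simp only [hpow] at h
  rw [show p / 2 - 1 = (p - 2) / 2 by ring, hpow] at h
  refine h.congr_fderiv ?_
  ext v
  simp
  ring

variable {n : ℕ}

lemma pd_norm_rpow (p : ℝ) {x : Euc n} (hx : x ≠ 0) (i : Fin n) :
    pd n i (fun y => ‖y‖ ^ p) x = p * ‖x‖ ^ (p - 2) * x i := by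
  rw [pd, (hasFDerivAt_norm_rpow_of_ne_zero p hx).fderiv]
  simp [EuclideanSpace.inner_single_right]

lemma pd2_norm_rpow (p : ℝ) {x : Euc n} (hx : x ≠ 0) (i j : Fin n) :
    pd2 n i j (fun y => ‖y‖ ^ p) x =
      p * ‖x‖ ^ (p - 2) * ((if i = j then 1 else 0) + (p - 2) / ‖x‖ ^ 2 * (x i * x j)) := by
  have hx0 : 0 < ‖x‖ := norm_pos_iff.mpr hx
  have hev : (fun y : Euc n => fderiv ℝ (fun y => ‖y‖ ^ p) y (EuclideanSpace.single j 1))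
      =ᶠ[nhds x] fun y => p * (‖y‖ ^ (p - 2) * y j) := by
    filter_upwards [isOpen_ne.mem_nhds hx] with y hy
    rw [← mul_assoc]
    exact pd_norm_rpow p hy j
  have hcoord : HasFDerivAt (fun y : Euc n => y j) (EuclideanSpace.proj j : Euc n →L[ℝ] ℝ) x :=
    (EuclideanSpace.proj j : Euc n →L[ℝ] ℝ).hasFDerivAt
  rw [pd2, hev.fderiv_eq,
    (((hasFDerivAt_norm_rpow_of_ne_zero (p - 2) hx).fun_mul hcoord).const_mul p).fderiv]
  have hpow : ‖x‖ ^ (p - 2 - 2) = ‖x‖ ^ (p - 2) / ‖x‖ ^ 2 := by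
    rw [Real.rpow_sub hx0 (p - 2) 2]
    norm_num
  simp [EuclideanSpace.inner_single_right, hpow, eq_comm]
  split_ifs <;> ring

lemma sum_mul_pd2_norm_rpow (p : ℝ) {x : Euc n} (hx : x ≠ 0) (A : Fin n → Fin n → ℝ) :
    ∑ i, ∑ j, A i j * pd2 n i j (fun y => ‖y‖ ^ p) x =
      p * ‖x‖ ^ (p - 2) *
        (∑ i, A i i + (p - 2) / ‖x‖ ^ 2 * ∑ i, ∑ j, A i j * x i * x j) := by
  have hdiag : ∑ i, A i i = ∑ i, ∑ j, A i j * (if i = j then 1 else 0) := by simp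
  rw [hdiag]
  simp only [pd2_norm_rpow p hx, Finset.mul_sum, ← Finset.sum_add_distrib]
  exact Finset.sum_congr rfl fun i _ => Finset.sum_congr rfl fun j _ => by ring

/-- The pairing of an elliptic matrix with the Hessian of a negative power of the norm. -/
lemma le_sum_mul_pd2_norm_rpow_neg {α : ℝ} (hα : 0 ≤ α) {x : Euc n} (hx : x ≠ 0)
    {A : Fin n → Fin n → ℝ} {c C : ℝ} (hdiag : ∀ i, A i i ≤ C)
    (hA : c * ∑ i, x i ^ 2 ≤ ∑ i, ∑ j, A i j * x i * x j) :
    α * ‖x‖ ^ (-α - 2) * ((α + 2) * c - n * C) ≤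
      ∑ i, ∑ j, A i j * pd2 n i j (fun y => ‖y‖ ^ (-α)) x := by
  have hx0 : 0 < ‖x‖ := norm_pos_iff.mpr hx
  have hns : ∑ i, x i ^ 2 = ‖x‖ ^ 2 := (EuclideanSpace.real_norm_sq_eq x).symm
  have htr : ∑ i, A i i ≤ n * C := by
    simpa using Finset.sum_le_sum fun i (_ : i ∈ Finset.univ) => hdiag i
  rw [hns, ← le_div_iff₀ (by positivity)] at hA
  rw [sum_mul_pd2_norm_rpow _ hx]
  have h1 : (α + 2) * c ≤ (α + 2) * ((∑ i, ∑ j, A i j * x i * x j) / ‖x‖ ^ 2) := by gcongr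
  have h2 : (0 : ℝ) ≤ α * ‖x‖ ^ (-α - 2) := by positivity
  calc _ ≤ α * ‖x‖ ^ (-α - 2) *
        ((α + 2) * ((∑ i, ∑ j, A i j * x i * x j) / ‖x‖ ^ 2) - ∑ i, A i i) := by gcongr
    _ = _ := by ring

lemma neg_le_sum_pd2_norm_rpow_neg {α : ℝ} (hα : 0 ≤ α) {x : Euc n} (hx : x ≠ 0)
    (v : Fin n → ℝ) :
    -(α * ‖x‖ ^ (-α - 2)) * ∑ i, v i ^ 2 ≤
      ∑ i, ∑ j, pd2 n i j (fun y => ‖y‖ ^ (-α)) x * v i * v j := by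
  have hx0 : 0 < ‖x‖ := norm_pos_iff.mpr hx
  have h := sum_mul_pd2_norm_rpow (-α) hx fun i j => v i * v j
  have hsq : ∑ i, ∑ j, v i * v j * x i * x j = (∑ i, v i * x i) ^ 2 := by
    rw [sq, Finset.sum_mul_sum]
    exact Finset.sum_congr rfl fun i _ => Finset.sum_congr rfl fun j _ => by ring
  have hv : ∑ i, v i * v i = ∑ i, v i ^ 2 := by simp only [sq]
  have hcomm : ∑ i, ∑ j, pd2 n i j (fun y => ‖y‖ ^ (-α)) x * v i * v j =
      ∑ i, ∑ j, v i * v j * pd2 n i j (fun y => ‖y‖ ^ (-α)) x :=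
    Finset.sum_congr rfl fun i _ => Finset.sum_congr rfl fun j _ => by ring
  rw [hcomm, h, hsq, hv]
  have h2 : (0 : ℝ) ≤
      α * ‖x‖ ^ (-α - 2) * ((α + 2) / ‖x‖ ^ 2 * (∑ i, v i * x i) ^ 2) := by positivity
  calc _ ≤ -(α * ‖x‖ ^ (-α - 2)) * ∑ i, v i ^ 2 +
        α * ‖x‖ ^ (-α - 2) * ((α + 2) / ‖x‖ ^ 2 * (∑ i, v i * x i) ^ 2) := by linarith
    _ = _ := by ring

end PowerOfNorm

section Interpolation

variable {n : ℕ}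

lemma gradient_phit {φ₀ φ₁ : Euc n → ℝ} {x : Euc n} (h₀ : DifferentiableAt ℝ φ₀ x)
    (h₁ : DifferentiableAt ℝ φ₁ x) (t : ℝ) :
    gradient (phit n φ₀ φ₁ t) x = (1 - t) • gradient φ₀ x + t • gradient φ₁ x := by
  unfold gradient phit
  rw [fderiv_fun_add (h₀.const_mul _) (h₁.const_mul _), fderiv_const_mul h₀, fderiv_const_mul h₁]
  simp

lemma mem_of_convex_fiber {U : Set (Euc n × ℝ × Euc n)} {x : Euc n}
    (hconv : Convex ℝ {rp : ℝ × Euc n | (x, rp.1, rp.2) ∈ U}) {φ₀ φ₁ : Euc n → ℝ}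
    (h₀ : DifferentiableAt ℝ φ₀ x) (h₁ : DifferentiableAt ℝ φ₁ x)
    (hU₀ : (x, φ₀ x, gradient φ₀ x) ∈ U) (hU₁ : (x, φ₁ x, gradient φ₁ x) ∈ U)
    {t : ℝ} (ht : t ∈ Set.Icc (0 : ℝ) 1) :
    (x, phit n φ₀ φ₁ t x, gradient (phit n φ₀ φ₁ t) x) ∈ U := by
  have := hconv (x := (φ₀ x, gradient φ₀ x)) hU₀ (y := (φ₁ x, gradient φ₁ x)) hU₁
    (sub_nonneg.mpr ht.2) ht.1 (sub_add_cancel 1 t)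
  rw [gradient_phit h₀ h₁]
  simpa [phit] using this

lemma continuous_phit_jet {φ₀ φ₁ : Euc n → ℝ} {x : Euc n} (h₀ : DifferentiableAt ℝ φ₀ x)
    (h₁ : DifferentiableAt ℝ φ₁ x) :
    Continuous fun t => (x, phit n φ₀ φ₁ t x, gradient (phit n φ₀ φ₁ t) x) := by
  simp only [gradient_phit h₀ h₁, phit]
  fun_prop

end Interpolation

section LinearizedCoefficients

variable {n : ℕ} {U : Set (Euc n × ℝ × Euc n)}
  {a : Euc n × ℝ × Euc n → Fin n → Fin n → ℝ} {b : Euc n × ℝ × Euc n → ℝ} {CE : ℝ}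

lemma UniformlyElliptic.diag_le (hell : UniformlyElliptic n U a b CE)
    {z : Euc n × ℝ × Euc n} (hz : z ∈ U) (i : Fin n) : a z i i ≤ CE := by
  obtain ⟨-, -, -, -, -, h, -⟩ := hell
  simpa [Pi.single_apply, ite_pow] using (h z hz (Pi.single i 1)).2

/-- A lower bound on the Hessian together with an upper bound on the operator gives an upper
bound on the Hessian. -/
lemma UniformlyElliptic.hessian_le (hell : UniformlyElliptic n U a b CE) (hCE : 0 < CE)
    {u : Euc n → ℝ} {x : Euc n} (hu : ContDiffAt ℝ 2 u x) (hU : (x, u x, gradient u x) ∈ U)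
    (hn : 0 < n) {c m : ℝ} (hc : 0 ≤ c) (hM : MEval n a b u x ≤ m)
    (hlow : ∀ v : Fin n → ℝ, -c * ∑ i, v i ^ 2 ≤ ∑ i, ∑ j, pd2 n i j u x * v i * v j)
    (v : Fin n → ℝ) :
    ∑ i, ∑ j, pd2 n i j u x * v i * v j ≤
      CE * (m + CE + n * (CE * c)) * ∑ i, v i ^ 2 := by
  have hdiag := fun i => hell.diag_le hU i
  obtain ⟨-, -, -, -, -, h, hbd⟩ := hell
  have hb := (abs_le.mp (hbd _ hU ⟨0, hn⟩ ⟨0, hn⟩ ⟨0, hn⟩).2.2.2.2).1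
  have hH := (posSemidef_hessM_add_smul_iff hu c).mpr hlow
  have htr := hH.mul_trace_le_sum fun ξ => (h _ hU ξ).1
  have hq := hH.quadratic_le_trace v
  have hpair : ∀ f : Fin n → Fin n → ℝ,
      ∑ i, ∑ j, f i j * (hessM n u x + c • (1 : Matrix (Fin n) (Fin n) ℝ)) i j =
        (∑ i, ∑ j, f i j * pd2 n i j u x) + c * ∑ i, f i i := fun f => by
    simp [hessM, Matrix.one_apply, mul_add, Finset.sum_add_distrib, Finset.mul_sum, mul_comm]
  have hqv : ∑ i, ∑ j, (hessM n u x + c • (1 : Matrix (Fin n) (Fin n) ℝ)) i j * v i * v j =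
      (∑ i, ∑ j, pd2 n i j u x * v i * v j) + c * ∑ i, v i ^ 2 := by
    have := hpair fun i j => v i * v j
    simp only [← sq] at this
    simpa only [mul_assoc, mul_comm, mul_left_comm] using this
  rw [hpair] at htr
  have hsum : ∑ i, a (x, u x, gradient u x) i i ≤ n * CE := by
    simpa using Finset.sum_le_sum fun i (_ : i ∈ Finset.univ) => hdiag i
  have hcsum := mul_le_mul_of_nonneg_left hsum hc
  rw [MEval] at hM
  have hT : ∑ i, (hessM n u x + c • (1 : Matrix (Fin n) (Fin n) ℝ)) i i ≤
      CE * (m + CE + n * (CE * c)) := by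
    rw [one_div, inv_mul_le_iff₀ hCE] at htr
    refine htr.trans (mul_le_mul_of_nonneg_left ?_ hCE.le)
    linarith
  have hv : 0 ≤ ∑ i, v i ^ 2 := Finset.sum_nonneg fun i _ => sq_nonneg _
  have := mul_le_mul_of_nonneg_right hT hv
  have := mul_nonneg hc hv
  linarith

lemma UniformlyElliptic.abs_Bcoef_le (hell : UniformlyElliptic n U a b CE)
    {φ₀ φ₁ : Euc n → ℝ} {x : Euc n} {C : ℝ}
    (hU : ∀ t ∈ Set.Icc (0 : ℝ) 1, (x, phit n φ₀ φ₁ t x, gradient (phit n φ₀ φ₁ t) x) ∈ U)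
    (hD : ∀ t ∈ Set.Icc (0 : ℝ) 1, ∀ i j, |pd2 n i j (phit n φ₀ φ₁ t) x| ≤ C) (i : Fin n) :
    |Bcoef n a b φ₀ φ₁ i x| ≤ n ^ 2 * (CE * C) + CE := by
  obtain ⟨-, -, -, -, -, -, hbd⟩ := hell
  have key := intervalIntegral.norm_integral_le_of_norm_le_const (a := (0 : ℝ)) (b := 1)
    (C := n ^ 2 * (CE * C) + CE)
    (f := fun t => (∑ j, ∑ k, da_p n a (x, phit n φ₀ φ₁ t x, gradient (phit n φ₀ φ₁ t) x) i j k *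
        pd2 n j k (phit n φ₀ φ₁ t) x) +
      db_p n b (x, phit n φ₀ φ₁ t x, gradient (phit n φ₀ φ₁ t) x) i) fun t ht => by
    rw [Set.uIoc_of_le zero_le_one] at ht
    have ht' : t ∈ Set.Icc (0 : ℝ) 1 := ⟨ht.1.le, ht.2⟩
    have hz := hU t ht'
    refine (norm_add_le _ _).trans (add_le_add ?_ (hbd _ hz i i i).2.2.1)
    have hjk : ∀ j k, ‖da_p n a (x, phit n φ₀ φ₁ t x, gradient (phit n φ₀ φ₁ t) x) i j k *
        pd2 n j k (phit n φ₀ φ₁ t) x‖ ≤ CE * C := fun j k => by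
      rw [norm_mul]
      exact mul_le_mul (hbd _ hz j k i).1 (hD t ht' j k) (norm_nonneg _)
        ((abs_nonneg _).trans (hbd _ hz j k i).1)
    calc _ ≤ ∑ _j : Fin n, ∑ _k : Fin n, CE * C :=
          norm_sum_le_of_le _ fun j _ => norm_sum_le_of_le _ fun k _ => hjk j k
      _ = _ := by simp; ring
  simpa [Bcoef] using key

lemma UniformlyElliptic.le_sum_Acoef_mul (hell : UniformlyElliptic n U a b CE)
    {φ₀ φ₁ : Euc n → ℝ} {x : Euc n} (h₀ : DifferentiableAt ℝ φ₀ x)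
    (h₁ : DifferentiableAt ℝ φ₁ x)
    (hU : ∀ t ∈ Set.Icc (0 : ℝ) 1, (x, phit n φ₀ φ₁ t x, gradient (phit n φ₀ φ₁ t) x) ∈ U)
    {W : Fin n → Fin n → ℝ} {m : ℝ} (hW : ∀ z ∈ U, m ≤ ∑ i, ∑ j, a z i j * W i j) :
    m ≤ ∑ i, ∑ j, Acoef n a φ₀ φ₁ i j x * W i j := by
  obtain ⟨-, hcont, -⟩ := hell
  have hc : ∀ i j, ContinuousOn
      (fun t => a (x, phit n φ₀ φ₁ t x, gradient (phit n φ₀ φ₁ t) x) i j * W i j)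
      (Set.uIcc 0 1) := fun i j => by
    rw [Set.uIcc_of_le zero_le_one]
    exact ((hcont i j).comp (continuous_phit_jet h₀ h₁).continuousOn hU).mul_const _
  have hrow : ∀ i, ContinuousOn
      (fun t => ∑ j, a (x, phit n φ₀ φ₁ t x, gradient (phit n φ₀ φ₁ t) x) i j * W i j)
      (Set.uIcc 0 1) := fun i => continuousOn_finsetSum _ fun j _ => hc i j
  have hsum : ∑ i, ∑ j, Acoef n a φ₀ φ₁ i j x * W i j = ∫ t in (0 : ℝ)..1, ∑ i, ∑ j,
      a (x, phit n φ₀ φ₁ t x, gradient (phit n φ₀ φ₁ t) x) i j * W i j := by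
    rw [intervalIntegral.integral_finsetSum fun i _ => (hrow i).intervalIntegrable]
    refine Finset.sum_congr rfl fun i _ => ?_
    rw [intervalIntegral.integral_finsetSum fun j _ => (hc i j).intervalIntegrable]
    exact Finset.sum_congr rfl fun j _ => (intervalIntegral.integral_mul_const _ _).symm
  have htotal : ContinuousOn (fun t => ∑ i, ∑ j,
      a (x, phit n φ₀ φ₁ t x, gradient (phit n φ₀ φ₁ t) x) i j * W i j) (Set.uIcc 0 1) :=
    continuousOn_finsetSum _ fun i _ => hrow i
  have := intervalIntegral.integral_mono_on (μ := MeasureTheory.volume) zero_le_one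
    (intervalIntegrable_const (c := m)) htotal.intervalIntegrable fun t ht => hW _ (hU t ht)
  rw [hsum]
  simpa using this

end LinearizedCoefficients

section Comparison

variable {n : ℕ}

/-- At a local maximum of `(φ₁ - φ₀) + δ w` the Hessian of `φ₁ + δ w` is at most that of `φ₀`. -/
lemma sum_pd2_add_le_of_isLocalMax {φ₀ φ₁ w : Euc n → ℝ} {x : Euc n} {δ : ℝ}
    (h₀ : ContDiffAt ℝ 2 φ₀ x) (h₁ : ContDiffAt ℝ 2 φ₁ x) (hw : ContDiffAt ℝ 2 w x)
    (hmax : IsLocalMax (fun y => (φ₁ y - φ₀ y) + δ * w y) x) (v : Fin n → ℝ) :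
    (∑ i, ∑ j, pd2 n i j φ₁ x * v i * v j) + δ * ∑ i, ∑ j, pd2 n i j w x * v i * v j ≤
      ∑ i, ∑ j, pd2 n i j φ₀ x * v i * v j := by
  have hf : (fun y => (φ₁ y - φ₀ y) + δ * w y) =
      fun y => 1 * (1 * φ₁ y + (-1) * φ₀ y) + δ * w y := by
    funext y
    ring
  rw [hf] at hmax
  have hdiff : ContDiffAt ℝ 2 (fun y => 1 * φ₁ y + (-1) * φ₀ y) x := by fun_prop
  have hcd : ContDiffAt ℝ 2 (fun y => 1 * (1 * φ₁ y + (-1) * φ₀ y) + δ * w y) x := by fun_prop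
  have h := fderiv_fderiv_nonpos_of_isLocalMax hcd hmax (WithLp.toLp 2 v)
  rw [← sum_pd2_mul_mul hcd] at h
  simp only [pd2_const_mul_add_const_mul hdiff hw, pd2_const_mul_add_const_mul h₁ h₀] at h
  simp only [add_mul, Finset.sum_add_distrib, one_mul, neg_mul, Finset.sum_neg_distrib, mul_assoc,
    ← Finset.mul_sum] at h
  simp only [mul_assoc]
  linarith

lemma abs_pd2_phit_le {φ₀ φ₁ : Euc n → ℝ} {x : Euc n} (h₀ : ContDiffAt ℝ 2 φ₀ x)
    (h₁ : ContDiffAt ℝ 2 φ₁ x) {c C : ℝ} (hcC : c ≤ C)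
    (hlow₀ : ∀ v : Fin n → ℝ, -c * ∑ i, v i ^ 2 ≤ ∑ i, ∑ j, pd2 n i j φ₀ x * v i * v j)
    (hlow₁ : ∀ v : Fin n → ℝ, -c * ∑ i, v i ^ 2 ≤ ∑ i, ∑ j, pd2 n i j φ₁ x * v i * v j)
    (hupp₀ : ∀ v : Fin n → ℝ, ∑ i, ∑ j, pd2 n i j φ₀ x * v i * v j ≤ C * ∑ i, v i ^ 2)
    (hupp₁ : ∀ v : Fin n → ℝ, ∑ i, ∑ j, pd2 n i j φ₁ x * v i * v j ≤ C * ∑ i, v i ^ 2)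
    {t : ℝ} (ht : t ∈ Set.Icc (0 : ℝ) 1) (i j : Fin n) :
    |pd2 n i j (phit n φ₀ φ₁ t) x| ≤ C := by
  have hD₀ := abs_entry_le_of_quadratic_bounds (pd2_symm h₀) hcC hlow₀ hupp₀ i j
  have hD₁ := abs_entry_le_of_quadratic_bounds (pd2_symm h₁) hcC hlow₁ hupp₁ i j
  have h1t : 0 ≤ 1 - t := sub_nonneg.mpr ht.2
  calc |pd2 n i j (phit n φ₀ φ₁ t) x|
      = |(1 - t) * pd2 n i j φ₀ x + t * pd2 n i j φ₁ x| := by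
        rw [← pd2_const_mul_add_const_mul h₀ h₁]
        rfl
    _ ≤ (1 - t) * |pd2 n i j φ₀ x| + t * |pd2 n i j φ₁ x| := by
        refine (abs_add_le _ _).trans_eq ?_
        rw [abs_mul, abs_mul, abs_of_nonneg h1t, abs_of_nonneg ht.1]
    _ ≤ (1 - t) * C + t * C :=
        add_le_add (mul_le_mul_of_nonneg_left hD₀ h1t) (mul_le_mul_of_nonneg_left hD₁ ht.1)
    _ = C := by ring

lemma neg_le_sum_mul_pd_norm_rpow_neg {α : ℝ} (hα : 0 ≤ α) {x : Euc n} (hx : x ≠ 0)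
    (hx1 : ‖x‖ ≤ 1) {B : Fin n → ℝ} {K : ℝ} (hB : ∀ i, |B i| ≤ K) :
    -(α * ‖x‖ ^ (-α - 2) * (n * K)) ≤ ∑ i, B i * pd n i (fun y => ‖y‖ ^ (-α)) x := by
  have hterm : ∀ i, -(α * ‖x‖ ^ (-α - 2) * K) ≤ B i * pd n i (fun y => ‖y‖ ^ (-α)) x :=
    fun i => by
      have hxi : |x i| ≤ 1 := (PiLp.norm_apply_le x i).trans hx1
      have hBx : |B i * x i| ≤ K := by
        rw [abs_mul]
        exact (mul_le_of_le_one_right (abs_nonneg _) hxi).trans (hB i)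
      have hP : (0 : ℝ) ≤ α * ‖x‖ ^ (-α - 2) := by positivity
      have := mul_le_mul_of_nonneg_left (abs_le.mp hBx).2 hP
      rw [pd_norm_rpow _ hx]
      linarith
  have := Finset.sum_le_sum fun i (_ : i ∈ Finset.univ) => hterm i
  simp only [Finset.sum_const, Finset.card_univ, Fintype.card_fin, nsmul_eq_mul] at this
  linarith

end Comparison

/-- Lemma 2.15: the linearized operator applied to the comparison function `w`
is at least `1` at the maximum point. -/
theorem linearized_operator_on_comparison_function
    (n : ℕ) (hn : 2 ≤ n) (CE CS : ℝ) (hCE : 1 ≤ CE) (hCS : 0 < CS)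
    (r₀ r₁ : ℝ) (hr₀ : 0 < r₀) (hr₁ : 0 < r₁) (hr₁r₀ : r₁ ≤ r₀) (h3r₀ : 3 * r₀ ≤ 1)
    (x₁ : Euc n) (hx₁ : ‖x₁‖ = 2 * r₀)
    (CH : ℝ) (hCH : CH = 2 * (CE ^ 2 * (((n : ℝ) - 1) * (CS + 1) + 2) + 1))
    (α : ℝ) (hα : α = -2 + CE * (1 + (n : ℝ) * CE + (n : ℝ) ^ 3 * CE * (CH + 1)))
    (δ : ℝ) (hδ : 0 < δ) (hδα : δ ≤ r₀ ^ (α + 2) / α)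
    (w : Euc n → ℝ) (hw : ∀ x, w x = ‖x‖ ^ (-α))
    (U : Set (Euc n × ℝ × Euc n)) (hUopen : IsOpen U)
    (hfiber : ∀ x : Euc n, Convex ℝ {rp : ℝ × Euc n | (x, rp.1, rp.2) ∈ U})
    (a : Euc n × ℝ × Euc n → Fin n → Fin n → ℝ) (b : Euc n × ℝ × Euc n → ℝ)
    (hell : UniformlyElliptic n U a b CE)
    (xst : Euc n) (hxst : xst ∈ Metric.ball x₁ r₁)
    (N : Set (Euc n)) (hNopen : IsOpen N) (hxstN : xst ∈ N)
    (φ₀ φ₁ : Euc n → ℝ)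
    (hφ₀ : ContDiffOn ℝ 2 φ₀ N) (hφ₁ : ContDiffOn ℝ 2 φ₁ N)
    (hadm₀ : UAdmissibleOn n U N φ₀) (hadm₁ : UAdmissibleOn n U N φ₁)
    (hmax : IsLocalMax (fun x => (φ₁ x - φ₀ x) + δ * w x) xst)
    (hhess₁ : (hessM n φ₁ xst + CS • (1 : Matrix (Fin n) (Fin n) ℝ)).PosSemidef)
    (hM₀ : MEval n a b φ₀ xst ≤ CE) :
    1 ≤ (∑ i, ∑ j, Acoef n a φ₀ φ₁ i j xst * pd2 n i j w xst) +
        (∑ i, Bcoef n a b φ₀ φ₁ i xst * pd n i w xst) := by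
  obtain rfl : w = fun x => ‖x‖ ^ (-α) := funext hw
  have hCE0 : 0 < CE := by linarith
  have hn2 : (2 : ℝ) ≤ n := by exact_mod_cast hn
  have hdist : ‖xst - x₁‖ < r₁ := by simpa [dist_eq_norm] using hxst
  have hlo : r₀ ≤ ‖xst‖ := by
    have := norm_sub_norm_le x₁ xst
    rw [norm_sub_rev] at this
    linarith
  have hhi : ‖xst‖ ≤ 1 := by
    have := norm_sub_norm_le xst x₁
    linarith
  have hx : xst ≠ 0 := norm_pos_iff.mp (hr₀.trans_le hlo)
  have hS : 0 ≤ CE ^ 2 * (((n : ℝ) - 1) * (CS + 1) + 2) :=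
    mul_nonneg (sq_nonneg _) (add_nonneg (mul_nonneg (by linarith) (by linarith)) (by norm_num))
  have hCH0 : 2 ≤ CH := by linarith
  have hnCE : 2 ≤ (n : ℝ) * CE := by nlinarith
  have hlast : 0 ≤ (n : ℝ) ^ 3 * CE * (CH + 1) := by positivity
  have hα1 : 1 ≤ α := by nlinarith
  have hP1 : 1 ≤ ‖xst‖ ^ (-α - 2) :=
    Real.one_le_rpow_of_pos_of_le_one_of_nonpos (hr₀.trans_le hlo) hhi (by linarith)
  have hδP : δ * (α * ‖xst‖ ^ (-α - 2)) ≤ 1 := by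
    have h1 : ‖xst‖ ^ (-α - 2) ≤ r₀ ^ (-α - 2) :=
      Real.rpow_le_rpow_of_nonpos hr₀ hlo (by linarith)
    have h2 : δ * α ≤ r₀ ^ (α + 2) := (le_div_iff₀ (by linarith)).mp hδα
    calc δ * (α * ‖xst‖ ^ (-α - 2)) = δ * α * ‖xst‖ ^ (-α - 2) := by ring
      _ ≤ r₀ ^ (α + 2) * r₀ ^ (-α - 2) := by gcongr
      _ = 1 := by
        rw [← Real.rpow_add hr₀]
        ring_nf
        exact Real.rpow_zero _
  have h₀ := hφ₀.contDiffAt (hNopen.mem_nhds hxstN)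
  have h₁ := hφ₁.contDiffAt (hNopen.mem_nhds hxstN)
  have hd₀ : DifferentiableAt ℝ φ₀ xst := h₀.differentiableAt (by norm_num)
  have hd₁ : DifferentiableAt ℝ φ₁ xst := h₁.differentiableAt (by norm_num)
  have hU : ∀ t ∈ Set.Icc (0 : ℝ) 1,
      (xst, phit n φ₀ φ₁ t xst, gradient (phit n φ₀ φ₁ t) xst) ∈ U := fun t ht =>
    mem_of_convex_fiber (hfiber xst) hd₀ hd₁ (hadm₀ _ hxstN) (hadm₁ _ hxstN) ht
  have hv0 : ∀ v : Fin n → ℝ, 0 ≤ ∑ i, v i ^ 2 := fun v =>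
    Finset.sum_nonneg fun i _ => sq_nonneg _
  have hcomp := sum_pd2_add_le_of_isLocalMax h₀ h₁ (contDiffAt_norm_rpow (-α) hx) hmax
  have hw_low : ∀ v : Fin n → ℝ, -∑ i, v i ^ 2 ≤
      δ * ∑ i, ∑ j, pd2 n i j (fun y => ‖y‖ ^ (-α)) xst * v i * v j := fun v => by
    have := mul_le_mul_of_nonneg_left
      (neg_le_sum_pd2_norm_rpow_neg (zero_le_one.trans hα1) hx v) hδ.le
    have := mul_le_mul_of_nonneg_right hδP (hv0 v)
    linarith
  have hlow₁ := (posSemidef_hessM_add_smul_iff h₁ CS).mp hhess₁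
  have hlow₀ : ∀ v : Fin n → ℝ, -(CS + 1) * ∑ i, v i ^ 2 ≤
      ∑ i, ∑ j, pd2 n i j φ₀ xst * v i * v j := fun v => by
    linarith [hlow₁ v, hw_low v, hcomp v]
  have hupp₀ := hell.hessian_le hCE0 h₀ (hadm₀ _ hxstN) (by omega) (by linarith) hM₀ hlow₀
  have hT : CE * (CE + CE + n * (CE * (CS + 1))) + 1 ≤ CH := by
    have : 0 ≤ CE ^ 2 * (((n : ℝ) - 2) * (CS + 1) + 2) :=
      mul_nonneg (sq_nonneg _)
        (add_nonneg (mul_nonneg (by linarith) (by linarith)) (by norm_num))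
    rw [hCH]
    linarith
  have hCS : CS + 1 ≤ CH := by
    have : 1 * (CS + 1) ≤ (CE * (n * CE)) * (CS + 1) := by
      gcongr
      nlinarith
    nlinarith
  have hpd2 : ∀ t ∈ Set.Icc (0 : ℝ) 1, ∀ i j, |pd2 n i j (phit n φ₀ φ₁ t) xst| ≤ CH :=
    fun t ht => abs_pd2_phit_le h₀ h₁ hCS hlow₀
      (fun v => by linarith [hlow₁ v, hv0 v])
      (fun v => by linarith [hupp₀ v, hv0 v, mul_le_mul_of_nonneg_right hT (hv0 v)])
      (fun v => by
        linarith [hupp₀ v, hw_low v, hcomp v, mul_le_mul_of_nonneg_right hT (hv0 v)])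
      ht
  have hB := neg_le_sum_mul_pd_norm_rpow_neg (zero_le_one.trans hα1) hx hhi
    (hell.abs_Bcoef_le hU hpd2)
  have hA := hell.le_sum_Acoef_mul hd₀ hd₁ hU fun z hz =>
    le_sum_mul_pd2_norm_rpow_neg (zero_le_one.trans hα1) hx (hell.diag_le hz)
      (hell.2.2.2.2.2.1 z hz xst).1
  have hconst : 1 ≤ (α + 2) * (1 / CE) - n * CE - n * ((n : ℝ) ^ 2 * (CE * CH) + CE) := by
    have h1 : (α + 2) * (1 / CE) = 1 + n * CE + (n : ℝ) ^ 3 * CE * (CH + 1) := by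
      rw [hα]
      field_simp
      ring
    have h2 : (n : ℝ) * CE ≤ (n : ℝ) ^ 3 * CE := by
      gcongr
      exact le_self_pow₀ (by linarith) (by norm_num)
    rw [h1]
    linarith
  have hαP : 1 ≤ α * ‖xst‖ ^ (-α - 2) := one_le_mul_of_one_le_of_one_le hα1 hP1
  have := mul_le_mul_of_nonneg_left hconst (zero_le_one.trans hαP)
  linarith

end
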